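/- Let b, c, d, f ∈ ℂ with Re b > 0, Re c > 0, and |ρ| < 1/2. Then Σ_{m=0}^∞ (ρ^m/m!) (c)_m · ₃F₂(−m, d, f; b, c; 1) = (1−ρ)^{−c} · ₂F₁(d, f; b; ρ/(ρ−1)). -/

import Mathlib

open Complex Finset

/-- The Pochhammer symbol (rising factorial) `(z)_n = z(z+1)⋯(z+n-1)`. -/
noncomputable def poch (z : ℂ) (n : ℕ) : ℂ := ∏ i ∈ Finset.range n, (z + i)

/-- The Gauss hypergeometric series `₂F₁(a, b; c; z)` as a formal sum. -/
noncomputable def F21 (a b c z : ℂ) : ℂ :=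
  ∑' n : ℕ, poch a n * poch b n / (poch c n * n.factorial) * z ^ n

/-- The terminating `₃F₂(-m, d, f; b, c; 1)`. -/
noncomputable def F32term (m : ℕ) (d f b c : ℂ) : ℂ :=
  ∑ l ∈ Finset.range (m + 1),
    poch (-(m : ℂ)) l * poch d l * poch f l / (poch b l * poch c l * l.factorial)

lemma poch_succ (z : ℂ) (n : ℕ) : poch z (n + 1) = poch z n * (z + n) :=
  Finset.prod_range_succ _ _

lemma poch_add (z : ℂ) (l k : ℕ) : poch z (l + k) = poch z l * poch (z + l) k := by
  simp only [poch, Finset.prod_range_add, Nat.cast_add, add_assoc]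

lemma poch_ne_zero {z : ℂ} (hz : 0 < z.re) (n : ℕ) : poch z n ≠ 0 := by
  refine Finset.prod_ne_zero_iff.2 fun i _ h => ?_
  have h' := congrArg Complex.re h
  simp only [add_re, natCast_re, zero_re] at h'
  have : (0 : ℝ) ≤ i := i.cast_nonneg
  linarith

lemma poch_neg_add_mul_factorial (l k : ℕ) :
    poch (-((l + k : ℕ) : ℂ)) l * k.factorial = (-1) ^ l * (l + k).factorial := by
  induction l generalizing k with
  | zero => simp [poch]
  | succ l ih =>
    have h := ih (k + 1)
    rw [Nat.factorial_succ, show l + (k + 1) = l + 1 + k by ring] at h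
    rw [poch_succ, pow_succ]
    push_cast at h ⊢
    linear_combination -h

lemma ringChoose_eq_poch_div_factorial (a : ℂ) (n : ℕ) :
    Ring.choose (a + n - 1) n = poch a n / n.factorial := by
  rw [eq_div_iff (by exact_mod_cast n.factorial_ne_zero), mul_comm, ← nsmul_eq_mul,
    ← Ring.multichoose_eq, Ring.factorial_nsmul_multichoose_eq_ascPochhammer,
    Polynomial.ascPochhammer_smeval_eq_eval]
  induction n with
  | zero => simp [poch]
  | succ n ih => rw [ascPochhammer_succ_eval, ih, poch_succ]

/-- The binomial series `∑ (a)_k x^k / k! = (1 - x)^(-a)`. -/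
lemma hasSum_poch_binomial (a : ℂ) {x : ℂ} (hx : ‖x‖ < 1) :
    HasSum (fun k : ℕ => poch a k / k.factorial * x ^ k) ((1 - x) ^ (-a)) := by
  have h := (one_div_one_sub_cpow_hasFPowerSeriesOnBall_zero a).hasSum (y := x)
    (by rw [← ENNReal.ofReal_one, Metric.eball_ofReal]; simpa using hx)
  simpa [FormalMultilinearSeries.ofScalars, ringChoose_eq_poch_div_factorial, cpow_neg] using h

lemma norm_poch_le (z : ℂ) (l k : ℕ) :
    ‖poch (z + l) k‖ ≤ ∏ i ∈ Finset.range k, (‖z‖ + l + i) := by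
  rw [poch, norm_prod]
  refine Finset.prod_le_prod (fun _ _ => norm_nonneg _) fun i _ => ?_
  calc ‖z + l + i‖ ≤ ‖z‖ + ‖(l : ℂ)‖ + ‖(i : ℂ)‖ := norm_add₃_le
    _ = _ := by simp

lemma hasSum_real_binomial (x : ℝ) {r : ℝ} (hr₀ : 0 ≤ r) (hr : r < 1) :
    HasSum (fun k : ℕ => (∏ i ∈ Finset.range k, (x + i)) / k.factorial * r ^ k)
      ((1 - r) ^ (-x)) := by
  have h := hasSum_poch_binomial (x : ℂ) (x := (r : ℂ)) (by simpa [abs_of_nonneg hr₀] using hr)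
  rw [← Complex.hasSum_ofReal, Complex.ofReal_cpow (by linarith)]
  simpa [poch] using h

lemma summable_norm_F21 (d f b : ℂ) {z : ℂ} (hz : ‖z‖ < 1) :
    Summable fun n : ℕ => ‖poch d n * poch f n / (poch b n * n.factorial) * z ^ n‖ := by
  obtain ⟨q, hzq, hq⟩ := exists_between hz
  have hlin (w : ℂ) :
      Filter.Tendsto (fun n : ℕ => (w + n) / (n : ℂ)) Filter.atTop (nhds 1) := by
    have h : Filter.Tendsto (fun n : ℕ => w / (n : ℂ) + 1) Filter.atTop (nhds (0 + 1)) :=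
      (tendsto_const_div_atTop_nhds_zero_nat w).add_const 1
    rw [zero_add] at h
    refine h.congr' ?_
    filter_upwards [Filter.eventually_ne_atTop 0] with n hn
    have : (n : ℂ) ≠ 0 := by exact_mod_cast hn
    field_simp
  have hlim : Filter.Tendsto (fun n : ℕ => ‖(d + n) * (f + n) / ((b + n) * (n + 1)) * z‖)
      Filter.atTop (nhds ‖z‖) := by
    have h := ((((hlin d).mul (hlin f)).div ((hlin b).mul (hlin 1)) (by simp)).mul_const z).norm
    simp only [mul_one, div_one, one_mul] at h
    refine h.congr' ?_
    filter_upwards [Filter.eventually_ne_atTop 0] with n hn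
    have : (n : ℂ) ≠ 0 := by exact_mod_cast hn
    simp only [Pi.div_apply]
    congr 2
    rw [div_mul_div_comm, div_mul_div_comm, div_div_div_cancel_right₀ (mul_ne_zero this this),
      add_comm (1 : ℂ)]
  refine summable_of_ratio_norm_eventually_le (r := q) hq ?_
  filter_upwards [hlim.eventually_le_const hzq] with n hn
  rw [norm_norm, norm_norm]
  refine le_trans (le_of_eq ?_) (mul_le_mul_of_nonneg_right hn (norm_nonneg _))
  rw [← norm_mul, poch_succ, poch_succ, poch_succ, Nat.factorial_succ, pow_succ]
  congr 1
  push_cast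
  simp only [div_eq_mul_inv, mul_inv]
  ring

/-- The double series obtained by expanding each terminating `₃F₂`. -/
noncomputable def doubleTerm (b c d f ρ : ℂ) (p : ℕ × ℕ) : ℂ :=
  poch d p.1 * poch f p.1 / (poch b p.1 * p.1.factorial) * (-ρ) ^ p.1 *
    (poch (c + p.1) p.2 / p.2.factorial * ρ ^ p.2)

lemma summable_doubleTerm (b c d f : ℂ) {ρ : ℂ} (hρ : ‖ρ‖ < 1 / 2) :
    Summable (doubleTerm b c d f ρ) := by
  set r := ‖ρ‖ with hr
  have hr₀ : 0 ≤ r := norm_nonneg ρ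
  have h1r : 0 < 1 - r := by linarith
  let A (l : ℕ) : ℝ := ‖poch d l * poch f l / (poch b l * l.factorial) * (-ρ) ^ l‖
  let g (p : ℕ × ℕ) : ℝ :=
    A p.1 * ((∏ i ∈ Finset.range p.2, (‖c‖ + p.1 + i)) / p.2.factorial * r ^ p.2)
  have hrow (l : ℕ) : HasSum (fun k => g (l, k)) (A l * (1 - r) ^ (-(‖c‖ + l))) :=
    (hasSum_real_binomial (‖c‖ + l) hr₀ (by linarith)).mul_left (A l)
  have hg : Summable g := by
    refine (summable_prod_of_nonneg fun p => ?_).2 ⟨fun l => (hrow l).summable, ?_⟩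
    · simp only [Pi.zero_apply, g, A]
      positivity
    · simp only [fun l => (hrow l).tsum_eq]
      have hz : ‖((r / (1 - r) : ℝ) : ℂ)‖ < 1 := by
        rw [norm_real, Real.norm_of_nonneg (by positivity), div_lt_one h1r]
        linarith
      refine ((summable_norm_F21 d f b hz).mul_left ((1 - r) ^ (-‖c‖))).congr fun l => ?_
      have h : ‖((r / (1 - r) : ℝ) : ℂ)‖ = r / (1 - r) := by
        rw [norm_real, Real.norm_of_nonneg (by positivity)]
      simp only [A]
      rw [norm_mul _ (_ ^ l), norm_mul _ (_ ^ l), norm_pow, norm_pow, h, norm_neg, neg_add,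
        Real.rpow_add h1r, Real.rpow_neg h1r.le (l : ℝ), Real.rpow_natCast, div_pow]
      ring
  refine hg.of_norm_bounded fun p => ?_
  rw [doubleTerm, norm_mul]
  refine mul_le_mul_of_nonneg_left ?_ (norm_nonneg _)
  rw [norm_mul, norm_div, norm_pow, norm_natCast]
  gcongr
  exact norm_poch_le c p.1 p.2

lemma sum_antidiagonal_doubleTerm (b c d f : ℂ) (hc : 0 < c.re) (ρ : ℂ) (m : ℕ) :
    ∑ p ∈ Finset.HasAntidiagonal.antidiagonal m, doubleTerm b c d f ρ p =
      ρ ^ m / m.factorial * poch c m * F32term m d f b c := by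
  rw [F32term, Finset.mul_sum, ← Finset.Nat.sum_antidiagonal_eq_sum_range_succ_mk
    (f := fun p : ℕ × ℕ => ρ ^ m / m.factorial * poch c m *
      (poch (-(m : ℂ)) p.1 * poch d p.1 * poch f p.1 / (poch b p.1 * poch c p.1 * p.1.factorial)))]
  refine Finset.sum_congr rfl fun p hp => ?_
  obtain ⟨l, k⟩ := p
  obtain rfl : l + k = m := by simpa using hp
  have hcl := poch_ne_zero hc l
  have hk : (k.factorial : ℂ) ≠ 0 := by exact_mod_cast k.factorial_ne_zero
  have hlk : ((l + k).factorial : ℂ) ≠ 0 := by exact_mod_cast (l + k).factorial_ne_zero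
  have h : poch (-((l + k : ℕ) : ℂ)) l = (-1) ^ l * (l + k).factorial / k.factorial := by
    rw [eq_div_iff hk, poch_neg_add_mul_factorial]
  simp only [doubleTerm]
  rw [h, poch_add c l k, neg_pow ρ, pow_add]
  simp only [div_eq_mul_inv, mul_inv]
  linear_combination (-(ρ ^ l * ρ ^ k * poch (c + l) k * (-1) ^ l * (k.factorial : ℂ)⁻¹ *
    poch d l * poch f l * (poch b l)⁻¹ * (l.factorial : ℂ)⁻¹)) *
    ((poch c l * (poch c l)⁻¹) * mul_inv_cancel₀ hlk + mul_inv_cancel₀ hcl)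

theorem cdh_lemma6_half (b c d f : ℂ) (hb : 0 < b.re) (hc : 0 < c.re)
    (ρ : ℂ) (hρ : ‖ρ‖ < 1 / 2) :
    (∑' m : ℕ, ρ ^ m / m.factorial * poch c m * F32term m d f b c) =
      (1 - ρ) ^ (-c) * F21 d f b (ρ / (ρ - 1)) := by
  have hs := summable_doubleTerm b c d f hρ
  have h1 : 1 - ρ ≠ 0 := by
    refine sub_ne_zero.2 fun h => ?_
    rw [← h, norm_one] at hρ
    norm_num at hρ
  have hrow (l : ℕ) : HasSum (fun k => doubleTerm b c d f ρ (l, k))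
      ((1 - ρ) ^ (-c) *
        (poch d l * poch f l / (poch b l * l.factorial) * (ρ / (ρ - 1)) ^ l)) := by
    have h := (hasSum_poch_binomial (c + l) (x := ρ) (by linarith)).mul_left
      (poch d l * poch f l / (poch b l * l.factorial) * (-ρ) ^ l)
    refine (congrArg (HasSum _) ?_).mp h
    rw [neg_add, cpow_add _ _ h1, cpow_neg _ (l : ℂ), cpow_natCast,
      show ρ / (ρ - 1) = -ρ / (1 - ρ) by rw [← neg_sub 1 ρ, div_neg, neg_div], div_pow]
    ring
  calc _ = ∑' m : ℕ, ∑ p ∈ Finset.HasAntidiagonal.antidiagonal m, doubleTerm b c d f ρ p := by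
        simp only [sum_antidiagonal_doubleTerm b c d f hc]
    _ = ∑' p : ℕ × ℕ, doubleTerm b c d f ρ p := by
        rw [← Finset.HasAntidiagonal.sigmaAntidiagonalEquivProd.tsum_eq]
        refine Eq.trans ?_
          ((Finset.HasAntidiagonal.sigmaAntidiagonalEquivProd.summable_iff.2 hs).tsum_sigma'
            fun n => (hasSum_fintype _).summable).symm
        refine tsum_congr fun m => ?_
        rw [tsum_fintype, ← Finset.sum_coe_sort]
        rfl
    _ = ∑' l : ℕ, ∑' k : ℕ, doubleTerm b c d f ρ (l, k) :=
        hs.tsum_prod' fun l => (hrow l).summable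
    _ = _ := by simp only [fun l => (hrow l).tsum_eq, F21, tsum_mul_left]
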